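/- arXiv:2211.15931 — 3 statements merged into one kernel-verified Lean document; each statement's English description precedes it below -/
import Mathlib

section
/- Let S be a nonempty finite set, P a row-stochastic matrix indexed by S×S, r : S → ℝ with 0 ≤ r(s) ≤ 1 for all s, λ : S → ℝ, and τ ≥ 0. Suppose that for every T ∈ ℕ and every s ∈ S, |Σ_{t=0}^{T−1} (P^t r)(s) − T·λ(s)| ≤ τ. Then for every γ ∈ [0,1) and every s ∈ S, |V_γ(P,r)(s) − λ(s)/(1−γ)| ≤ τ. -/
open Matrix

/-- Abel summation bound: discounting a real sequence, up to the boundary term, by powers of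
`γ ∈ [0, 1]` costs at most `(1 - γ ^ T) * C` when its partial sums are bounded by `C`. -/
lemma abs_sum_pow_mul_sub_le {b : ℕ → ℝ} {C γ : ℝ}
    (hb : ∀ T : ℕ, |∑ t ∈ Finset.range T, b t| ≤ C) (hγ0 : 0 ≤ γ) (hγ1 : γ ≤ 1) (T : ℕ) :
    |(∑ t ∈ Finset.range T, γ ^ t * b t) - γ ^ T * ∑ t ∈ Finset.range T, b t|
      ≤ (1 - γ ^ T) * C := by
  induction T with
  | zero => simp
  | succ n ih =>
    have hsplit : (∑ t ∈ Finset.range (n + 1), γ ^ t * b t)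
          - γ ^ (n + 1) * ∑ t ∈ Finset.range (n + 1), b t
        = ((∑ t ∈ Finset.range n, γ ^ t * b t) - γ ^ n * ∑ t ∈ Finset.range n, b t)
          + (1 - γ) * γ ^ n * ∑ t ∈ Finset.range (n + 1), b t := by
      simp only [Finset.sum_range_succ]
      ring
    have hc : 0 ≤ (1 - γ) * γ ^ n := mul_nonneg (sub_nonneg.2 hγ1) (pow_nonneg hγ0 n)
    rw [hsplit]
    calc _ ≤ _ := abs_add_le _ _
      _ ≤ (1 - γ ^ n) * C + (1 - γ) * γ ^ n * C := by
        rw [abs_mul _ (∑ t ∈ Finset.range (n + 1), b t), abs_of_nonneg hc]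
        exact add_le_add ih (mul_le_mul_of_nonneg_left (hb _) hc)
      _ = (1 - γ ^ (n + 1)) * C := by ring

/-- Discounted partial sums obey the same bound as the undiscounted partial sums. -/
lemma abs_sum_pow_mul_le {b : ℕ → ℝ} {C γ : ℝ}
    (hb : ∀ T : ℕ, |∑ t ∈ Finset.range T, b t| ≤ C) (hγ0 : 0 ≤ γ) (hγ1 : γ ≤ 1) (T : ℕ) :
    |∑ t ∈ Finset.range T, γ ^ t * b t| ≤ C := by
  have hboundary : |γ ^ T * ∑ t ∈ Finset.range T, b t| ≤ γ ^ T * C := by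
    rw [abs_mul, abs_of_nonneg (pow_nonneg hγ0 T)]
    exact mul_le_mul_of_nonneg_left (hb T) (pow_nonneg hγ0 T)
  have h := abs_sub_abs_le_abs_sub (∑ t ∈ Finset.range T, γ ^ t * b t)
    (γ ^ T * ∑ t ∈ Finset.range T, b t)
  linarith [abs_sum_pow_mul_sub_le hb hγ0 hγ1 T]

/-- A sequence with bounded partial sums is summable after discounting. -/
lemma summable_pow_mul_of_abs_sum_le {b : ℕ → ℝ} {C γ : ℝ}
    (hb : ∀ T : ℕ, |∑ t ∈ Finset.range T, b t| ≤ C) (hγ0 : 0 ≤ γ) (hγ1 : γ < 1) :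
    Summable fun t => γ ^ t * b t := by
  refine Summable.of_norm_bounded ((summable_geometric_of_lt_one hγ0 hγ1).mul_right (C + C)) ?_
  intro t
  rw [Real.norm_eq_abs, abs_mul, abs_of_nonneg (pow_nonneg hγ0 t)]
  refine mul_le_mul_of_nonneg_left ?_ (pow_nonneg hγ0 t)
  rw [← Finset.sum_range_succ_sub_sum b]
  exact (abs_sub _ _).trans (add_le_add (hb _) (hb _))

/-- Lemma 2 of Dong et al. / Lemma 1 of the paper: if the reward averaging
time of the policy with transition matrix `P` and rewards `r` is at most `τ`, i.e.
`|∑_{t=0}^{T-1} (P^t r)(s) - T λ(s)| ≤ τ` for all horizons `T` and states `s`, then the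
`γ`-discounted value satisfies `|V_γ(P,r)(s) - λ(s)/(1-γ)| ≤ τ`. -/
theorem discounted_value_close_to_average_reward
    {S : Type*} [Fintype S] [Nonempty S] [DecidableEq S]
    (P : Matrix S S ℝ)
    (hP0 : ∀ s s' : S, 0 ≤ P s s') (hP1 : ∀ s : S, ∑ s' : S, P s s' = 1)
    (r : S → ℝ) (hr0 : ∀ s : S, 0 ≤ r s) (hr1 : ∀ s : S, r s ≤ 1)
    (lam : S → ℝ) (τ : ℝ) (hτ : 0 ≤ τ)
    (havg : ∀ T : ℕ, ∀ s : S,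
      |(∑ t ∈ Finset.range T, ((P ^ t).mulVec r) s) - T * lam s| ≤ τ)
    (γ : ℝ) (hγ0 : 0 ≤ γ) (hγ1 : γ < 1) (s : S) :
    |(∑' h : ℕ, γ ^ h * ((P ^ h).mulVec r) s) - lam s / (1 - γ)| ≤ τ := by
  have hb : ∀ T : ℕ, |∑ t ∈ Finset.range T, (((P ^ t).mulVec r) s - lam s)| ≤ τ := by
    intro T
    simpa [Finset.sum_sub_distrib] using havg T s
  have hsum := (summable_pow_mul_of_abs_sum_le hb hγ0 hγ1).hasSum
  have hvalue := hsum.add ((hasSum_geometric_of_lt_one hγ0 hγ1).mul_right (lam s))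
  simp only [← mul_add, sub_add_cancel] at hvalue
  rw [hvalue.tsum_eq, div_eq_inv_mul, add_sub_cancel_right]
  exact le_of_tendsto hsum.tendsto_sum_nat.abs
    (Filter.Eventually.of_forall (abs_sum_pow_mul_le hb hγ0 hγ1.le))
end

section
/- Let S be a nonempty finite set, P a row-stochastic matrix indexed by S×S, r : S → ℝ with 0 ≤ r(s) ≤ 1 for all s, λ ∈ ℝ, and τ ≥ 0. Suppose that for every T ∈ ℕ and every s ∈ S, |Σ_{t=0}^{T−1} (P^t r)(s) − T·λ| ≤ τ. Then for every γ ∈ [0,1) and all s, s' ∈ S, |V_γ(P,r)(s) − V_γ(P,r)(s')| ≤ 2τ. -/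
open Matrix

theorem sum_pow_mul_eq_summation_by_parts (a : ℕ → ℝ) (γ : ℝ) (n : ℕ) :
    ∑ h ∈ Finset.range n, γ ^ h * a h =
      γ ^ n * ∑ t ∈ Finset.range n, a t +
        (1 - γ) * ∑ h ∈ Finset.range n, γ ^ h * ∑ t ∈ Finset.range (h + 1), a t := by
  induction n with
  | zero => simp
  | succ n ih =>
    rw [Finset.sum_range_succ, ih, Finset.sum_range_succ (fun h => γ ^ h * _),
      Finset.sum_range_succ a]
    ring

theorem abs_sum_pow_mul_le_of_partial_sums {a : ℕ → ℝ} {C γ : ℝ}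
    (ha : ∀ T, |∑ t ∈ Finset.range T, a t| ≤ C) (hγ0 : 0 ≤ γ) (hγ1 : γ ≤ 1) (n : ℕ) :
    |∑ h ∈ Finset.range n, γ ^ h * a h| ≤ C := by
  have hsum : |∑ h ∈ Finset.range n, γ ^ h * ∑ t ∈ Finset.range (h + 1), a t| ≤
      (∑ h ∈ Finset.range n, γ ^ h) * C := by
    rw [Finset.sum_mul]
    refine (Finset.abs_sum_le_sum_abs _ _).trans (Finset.sum_le_sum fun h _ => ?_)
    rw [abs_mul, abs_of_nonneg (pow_nonneg hγ0 h)]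
    exact mul_le_mul_of_nonneg_left (ha _) (pow_nonneg hγ0 h)
  rw [sum_pow_mul_eq_summation_by_parts]
  calc
    _ ≤ γ ^ n * |∑ t ∈ Finset.range n, a t| +
        (1 - γ) * |∑ h ∈ Finset.range n, γ ^ h * ∑ t ∈ Finset.range (h + 1), a t| := by
      refine (abs_add_le _ _).trans_eq ?_
      rw [abs_mul, abs_mul, abs_of_nonneg (pow_nonneg hγ0 n), abs_of_nonneg (sub_nonneg.2 hγ1)]
    _ ≤ γ ^ n * C + (1 - γ) * ((∑ h ∈ Finset.range n, γ ^ h) * C) :=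
      add_le_add (mul_le_mul_of_nonneg_left (ha n) (pow_nonneg hγ0 n))
        (mul_le_mul_of_nonneg_left hsum (sub_nonneg.2 hγ1))
    _ = C := by linear_combination C * mul_neg_geom_sum γ n

theorem summable_pow_mul_of_partial_sums {a : ℕ → ℝ} {C γ : ℝ}
    (ha : ∀ T, |∑ t ∈ Finset.range T, a t| ≤ C) (hγ0 : 0 ≤ γ) (hγ1 : γ < 1) :
    Summable fun h => γ ^ h * a h := by
  refine Summable.of_norm_bounded
    ((summable_geometric_of_lt_one hγ0 hγ1).mul_right (2 * C)) fun h => ?_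
  rw [Real.norm_eq_abs, abs_mul, abs_of_nonneg (pow_nonneg hγ0 h)]
  refine mul_le_mul_of_nonneg_left ?_ (pow_nonneg hγ0 h)
  have hsucc := ha (h + 1)
  rw [Finset.sum_range_succ] at hsucc
  have hh := ha h
  rw [abs_le] at *
  constructor <;> linarith

theorem abs_tsum_pow_mul_le_of_partial_sums {a : ℕ → ℝ} {C γ : ℝ}
    (ha : ∀ T, |∑ t ∈ Finset.range T, a t| ≤ C) (hγ0 : 0 ≤ γ) (hγ1 : γ < 1) :
    |∑' h, γ ^ h * a h| ≤ C :=
  le_of_tendsto'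
    (summable_pow_mul_of_partial_sums ha hγ0 hγ1).hasSum.tendsto_sum_nat.abs
    (abs_sum_pow_mul_le_of_partial_sums ha hγ0 hγ1.le)

theorem abs_tsum_pow_mul_sub_le {x : ℕ → ℝ} {lam C γ : ℝ}
    (hx : ∀ T : ℕ, |∑ t ∈ Finset.range T, x t - T * lam| ≤ C) (hγ0 : 0 ≤ γ) (hγ1 : γ < 1) :
    |∑' h, γ ^ h * x h - (∑' h, γ ^ h) * lam| ≤ C := by
  have ha : ∀ T, |∑ t ∈ Finset.range T, (x t - lam)| ≤ C := fun T => by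
    simpa [Finset.sum_sub_distrib] using hx T
  have hgeom := (summable_geometric_of_lt_one hγ0 hγ1).mul_right lam
  have hsplit : ∑' h, γ ^ h * x h = ∑' h, γ ^ h * (x h - lam) + (∑' h, γ ^ h) * lam := by
    rw [← tsum_mul_right,
      ← (summable_pow_mul_of_partial_sums ha hγ0 hγ1).tsum_add hgeom]
    exact tsum_congr fun h => by ring
  rw [hsplit, add_sub_cancel_right]
  exact abs_tsum_pow_mul_le_of_partial_sums ha hγ0 hγ1

/-- if the average reward `λ` is the same constant for all starting states
and the reward averaging time is at most `τ`, then the span of the `γ`-discounted value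
function is bounded by `2τ`. -/
theorem discounted_value_span_le_two_tau
    {S : Type*} [Fintype S] [Nonempty S] [DecidableEq S]
    (P : Matrix S S ℝ)
    (hP0 : ∀ s s' : S, 0 ≤ P s s') (hP1 : ∀ s : S, ∑ s' : S, P s s' = 1)
    (r : S → ℝ) (hr0 : ∀ s : S, 0 ≤ r s) (hr1 : ∀ s : S, r s ≤ 1)
    (lam : ℝ) (τ : ℝ) (hτ : 0 ≤ τ)
    (havg : ∀ T : ℕ, ∀ s : S,
      |(∑ t ∈ Finset.range T, ((P ^ t).mulVec r) s) - T * lam| ≤ τ)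
    (γ : ℝ) (hγ0 : 0 ≤ γ) (hγ1 : γ < 1) (s s' : S) :
    |(∑' h : ℕ, γ ^ h * ((P ^ h).mulVec r) s)
      - ∑' h : ℕ, γ ^ h * ((P ^ h).mulVec r) s'| ≤ 2 * τ := by
  have hs := abs_tsum_pow_mul_sub_le (fun T => havg T s) hγ0 hγ1
  have hs' := abs_tsum_pow_mul_sub_le (fun T => havg T s') hγ0 hγ1
  rw [abs_le] at *
  constructor <;> linarith
end

section
/- Let S be a nonempty finite set, let P and Q be row-stochastic matrices indexed by S×S, let γ ∈ [0,1), and let r : S → ℝ with 0 ≤ r(s) ≤ 1 for all s. Then, entrywise, V_γ(P,r) − V_γ(Q,r) = Σ_{t=0}^∞ γ^{t+1} · P^t · (P − Q) · V_γ(Q,r), where the series on the right converges absolutely in every entry. -/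
open Matrix

/-- The discounted series `∑ γ ^ t * (P ^ t *ᵥ v) s` of a row-stochastic matrix converges
absolutely. -/
theorem summable_abs_discounted_pow_mulVec {S : Type*} [Fintype S] [DecidableEq S]
    {P : Matrix S S ℝ} (hP : P ∈ rowStochastic ℝ S) {γ : ℝ} (hγ0 : 0 ≤ γ) (hγ1 : γ < 1)
    (v : S → ℝ) (s : S) : Summable fun t : ℕ => |γ ^ t * ((P ^ t) *ᵥ v) s| := by
  refine Summable.of_nonneg_of_le (fun _ => abs_nonneg _) (fun t => ?_)
    ((summable_geometric_of_lt_one hγ0 hγ1).mul_right (∑ i, |v i|))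
  have hPt : P ^ t ∈ rowStochastic ℝ S := pow_mem hP t
  rw [abs_mul, abs_of_nonneg (pow_nonneg hγ0 t)]
  gcongr
  refine (Finset.abs_sum_le_sum_abs _ _).trans (Finset.sum_le_sum fun i _ => ?_)
  rw [abs_mul, abs_of_nonneg (nonneg_of_mem_rowStochastic hPt)]
  exact mul_le_of_le_one_left (abs_nonneg _) (le_one_of_mem_rowStochastic hPt)

theorem summable_discounted_pow_mulVec {S : Type*} [Fintype S] [DecidableEq S]
    {P : Matrix S S ℝ} (hP : P ∈ rowStochastic ℝ S) {γ : ℝ} (hγ0 : 0 ≤ γ) (hγ1 : γ < 1)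
    (v : S → ℝ) (s : S) : Summable fun t : ℕ => γ ^ t * ((P ^ t) *ᵥ v) s :=
  (summable_abs_discounted_pow_mulVec hP hγ0 hγ1 v s).of_abs

/-- The Bellman equation for the discounted value. -/
theorem tsum_discounted_pow_mulVec_eq {S : Type*} [Fintype S] [DecidableEq S]
    {P : Matrix S S ℝ} (hP : P ∈ rowStochastic ℝ S) {γ : ℝ} (hγ0 : 0 ≤ γ) (hγ1 : γ < 1)
    (v : S → ℝ) (s : S) :
    ∑' t : ℕ, γ ^ t * ((P ^ t) *ᵥ v) s =
      v s + γ * (P *ᵥ fun s' => ∑' t : ℕ, γ ^ t * ((P ^ t) *ᵥ v) s') s := by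
  have hsum := summable_discounted_pow_mulVec hP hγ0 hγ1 v
  rw [(hsum s).tsum_eq_zero_add]
  simp only [pow_zero, one_mulVec, one_mul]
  congr 1
  change _ = γ * ∑ i, P s i * ∑' t : ℕ, γ ^ t * ((P ^ t) *ᵥ v) i
  simp only [← tsum_mul_left]
  rw [← Summable.tsum_finsetSum fun i _ => (hsum i).mul_left (P s i), ← tsum_mul_left]
  refine tsum_congr fun t => ?_
  rw [pow_succ' P, ← mulVec_mulVec]
  simp only [mulVec, dotProduct, Finset.mul_sum]
  refine Finset.sum_congr rfl fun i _ => Finset.sum_congr rfl fun j _ => by ring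

/-- value decomposition: for row-stochastic matrices `P`, `Q`, `γ ∈ [0,1)`
and rewards `r` with values in `[0,1]`, entrywise
`V_γ(P,r) - V_γ(Q,r) = ∑_{t=0}^∞ γ^{t+1} P^t (P - Q) V_γ(Q,r)`, with the series on the
right converging absolutely in every entry. -/
theorem value_decomposition
    {S : Type*} [Fintype S] [Nonempty S] [DecidableEq S]
    (P Q : Matrix S S ℝ)
    (hP0 : ∀ s s' : S, 0 ≤ P s s') (hP1 : ∀ s : S, ∑ s' : S, P s s' = 1)
    (hQ0 : ∀ s s' : S, 0 ≤ Q s s') (hQ1 : ∀ s : S, ∑ s' : S, Q s s' = 1)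
    (γ : ℝ) (hγ0 : 0 ≤ γ) (hγ1 : γ < 1)
    (r : S → ℝ) (hr0 : ∀ s : S, 0 ≤ r s) (hr1 : ∀ s : S, r s ≤ 1) :
    ∀ s : S,
      (Summable fun t : ℕ =>
        |γ ^ (t + 1) *
          ((P ^ t).mulVec ((P - Q).mulVec
            (fun s' : S => ∑' h : ℕ, γ ^ h * ((Q ^ h).mulVec r) s'))) s|) ∧
      (∑' h : ℕ, γ ^ h * ((P ^ h).mulVec r) s)
          - (∑' h : ℕ, γ ^ h * ((Q ^ h).mulVec r) s)
        = ∑' t : ℕ,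
            γ ^ (t + 1) *
              ((P ^ t).mulVec ((P - Q).mulVec
                (fun s' : S => ∑' h : ℕ, γ ^ h * ((Q ^ h).mulVec r) s'))) s := by
  have hP : P ∈ rowStochastic ℝ S := mem_rowStochastic_iff_sum.2 ⟨hP0, hP1⟩
  have hQ : Q ∈ rowStochastic ℝ S := mem_rowStochastic_iff_sum.2 ⟨hQ0, hQ1⟩
  intro s
  have bellman := tsum_discounted_pow_mulVec_eq hQ hγ0 hγ1 r
  set V : S → ℝ := fun s' => ∑' h : ℕ, γ ^ h * ((Q ^ h).mulVec r) s'
  have habs : Summable fun t : ℕ =>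
      |γ ^ (t + 1) * ((P ^ t).mulVec ((P - Q).mulVec V)) s| := by
    refine ((summable_abs_discounted_pow_mulVec hP hγ0 hγ1 ((P - Q) *ᵥ V) s).mul_left |γ|).congr
      fun t => ?_
    rw [← abs_mul, pow_succ', mul_assoc]
  refine ⟨habs, ?_⟩
  have hr : r = V - γ • (Q *ᵥ V) := by
    ext i
    simp only [Pi.sub_apply, Pi.smul_apply, smul_eq_mul]
    linarith [bellman i]
  have hsumV := summable_discounted_pow_mulVec hP hγ0 hγ1 V s
  have hterm : ∀ t : ℕ, γ ^ t * ((P ^ t) *ᵥ r) s -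
      γ ^ (t + 1) * ((P ^ t) *ᵥ ((P - Q) *ᵥ V)) s =
      γ ^ t * ((P ^ t) *ᵥ V) s - γ ^ (t + 1) * ((P ^ (t + 1)) *ᵥ V) s := by
    intro t
    have hrt : (P ^ t) *ᵥ r = (P ^ t) *ᵥ V - γ • ((P ^ t) *ᵥ (Q *ᵥ V)) := by
      rw [← mulVec_smul, ← mulVec_sub, ← hr]
    rw [hrt, sub_mulVec, mulVec_sub, pow_succ P, ← mulVec_mulVec]
    simp only [Pi.sub_apply, Pi.smul_apply, smul_eq_mul]
    ring
  have htel : (∑' h : ℕ, γ ^ h * ((P ^ h) *ᵥ r) s) -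
      ∑' t : ℕ, γ ^ (t + 1) * ((P ^ t) *ᵥ ((P - Q) *ᵥ V)) s = V s := by
    rw [← (summable_discounted_pow_mulVec hP hγ0 hγ1 r s).tsum_sub habs.of_abs,
      tsum_congr hterm, hsumV.tsum_sub ((summable_nat_add_iff 1).2 hsumV),
      hsumV.tsum_eq_zero_add]
    simp
  change _ - V s = _
  linarith
end
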